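/- arXiv:1709.04567 — 2 statements merged into one kernel-verified Lean document; each statement's English description precedes it below -/
import Mathlib

section
/- Let n ∈ ω and let (A_k)_{k<n} be analytic subsets of 2^ω such that for each k < n there is a Borel reduction of E_0 into E_0 ↾ A_k, and such that [A_k]_{E_0} ⊆ [A_{k+1}]_{E_0} for all k < n−1. Then there exist finite binary strings s_0,…,s_{n−1}, all of the same length, and a single family of finite binary strings (v_m^i)_{m∈ω, i∈{0,1}} with v_m^i(0) = i and |v_m^0| = |v_m^1| for all m, such that for every k < n the E_0-tree map with stem s_k and blocks (v_m^i) has range contained in A_k. -/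
open Set Function

/-- The eventual-agreement equivalence relation `E₀`: `x E₀ y` iff `∃ n ∀ k > n, x k = y k`. -/
def E0 {α : Type*} (x y : ℕ → α) : Prop := ∃ n, ∀ k > n, x k = y k

/-- The `E₀`-saturation of a set. -/
def satE0 (A : Set (ℕ → Bool)) : Set (ℕ → Bool) := {y | ∃ x ∈ A, E0 x y}

/-- The finite initial segment `s ⌢ v 0 (x 0) ⌢ ⋯ ⌢ v (n-1) (x (n-1))`. -/
def blockPrefix (s : List Bool) (v : ℕ → Bool → List Bool) (x : ℕ → Bool) : ℕ → List Bool
  | 0 => s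
  | n + 1 => blockPrefix s v x n ++ v n (x n)

/-- The map `x ↦ s ⌢ v 0 (x 0) ⌢ v 1 (x 1) ⌢ ⋯` determined by a stem `s` and blocks `v`. -/
def e0TreeMapOf (s : List Bool) (v : ℕ → Bool → List Bool) (x : ℕ → Bool) : ℕ → Bool :=
  fun m => (blockPrefix s v x (m + 1)).getD m false

/-- Conditions on the blocks of an `E₀`-tree: `v n i` starts with `i` and the two blocks at
each level have equal length. -/
def IsE0Blocks (v : ℕ → Bool → List Bool) : Prop :=
  (∀ n i, (v n i).head? = some i) ∧ ∀ n, (v n false).length = (v n true).length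

open MeasureTheory Filter Topology

section E0

variable {x y z : ℕ → Bool}

theorem E0.symm (h : E0 x y) : E0 y x :=
  let ⟨n, hn⟩ := h
  ⟨n, fun k hk => (hn k hk).symm⟩

theorem E0.trans (h : E0 x y) (h' : E0 y z) : E0 x z :=
  let ⟨n, hn⟩ := h
  let ⟨m, hm⟩ := h'
  ⟨max n m, fun k hk => (hn k (lt_of_le_of_lt (le_max_left _ _) hk)).trans
    (hm k (lt_of_le_of_lt (le_max_right _ _) hk))⟩

/-- Flip the coordinates of `x` that lie in `a`. -/
def flipOn (a : Set ℕ) [DecidablePred (· ∈ a)] (x : ℕ → Bool) : ℕ → Bool :=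
  fun k => xor (decide (k ∈ a)) (x k)

theorem flipOn_flipOn (a : Set ℕ) [DecidablePred (· ∈ a)] (x : ℕ → Bool) :
    flipOn a (flipOn a x) = x := by
  funext k
  simp [flipOn]

theorem continuous_flipOn (a : Set ℕ) [DecidablePred (· ∈ a)] : Continuous (flipOn a) :=
  continuous_pi fun k =>
    (continuous_of_discreteTopology (f := fun b => xor (decide (k ∈ a)) b)).comp
      (continuous_apply k)

theorem flipOn_empty (x : ℕ → Bool) : flipOn ((∅ : Finset ℕ) : Set ℕ) x = x := by
  funext k
  simp [flipOn]

/-- `flipOn a` as a homeomorphism of Cantor space. -/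
def flipHomeomorph (a : Set ℕ) [DecidablePred (· ∈ a)] : (ℕ → Bool) ≃ₜ (ℕ → Bool) where
  toFun := flipOn a
  invFun := flipOn a
  left_inv := flipOn_flipOn a
  right_inv := flipOn_flipOn a
  continuous_toFun := continuous_flipOn a
  continuous_invFun := continuous_flipOn a

theorem eventually_residual_flipOn (a : Set ℕ) [DecidablePred (· ∈ a)]
    {p : (ℕ → Bool) → Prop} (h : ∀ᶠ x in residual (ℕ → Bool), p x) :
    ∀ᶠ x in residual (ℕ → Bool), p (flipOn a x) :=
  tendsto_residual_of_isOpenMap (continuous_flipOn a) (flipHomeomorph a).isOpenMap h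

theorem E0.flipOn_left (a : Finset ℕ) (x : ℕ → Bool) : E0 (flipOn (a : Set ℕ) x) x := by
  refine ⟨a.sup id, fun k hk => ?_⟩
  have : k ∉ a := fun h => absurd (Finset.le_sup (f := id) h) (not_le.2 hk)
  simp [flipOn, this]

theorem E0.exists_eq_flipOn (h : E0 x y) : ∃ a : Finset ℕ, y = flipOn (a : Set ℕ) x := by
  obtain ⟨n, hn⟩ := h
  refine ⟨(Finset.range (n + 1)).filter fun k => x k ≠ y k, funext fun k => ?_⟩
  by_cases hk : n < k
  · have : ¬ k < n + 1 := by omega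
    simp [flipOn, hn k hk]
  · cases hx : x k <;> cases hy : y k <;> simp [flipOn, hx, hy, not_lt.1 hk]

/-- The `E₀`-saturation of a Borel set, written in terms of finite flips, is Borel. -/
theorem measurableSet_exists_flipOn {S : Set (ℕ → Bool)} (hS : MeasurableSet S) :
    MeasurableSet {x | ∃ a : Finset ℕ, flipOn (a : Set ℕ) x ∈ S} := by
  have : {x | ∃ a : Finset ℕ, flipOn (a : Set ℕ) x ∈ S} =
      ⋃ a : Finset ℕ, flipOn (a : Set ℕ) ⁻¹' S := by
    ext; simp
  rw [this]
  exact MeasurableSet.iUnion fun a => (continuous_flipOn _).measurable hS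

theorem exists_flipOn_congr {S : Set (ℕ → Bool)} (h : E0 x y)
    (hx : ∃ a : Finset ℕ, flipOn (a : Set ℕ) x ∈ S) :
    ∃ a : Finset ℕ, flipOn (a : Set ℕ) y ∈ S := by
  obtain ⟨a, ha⟩ := hx
  obtain ⟨b, hb⟩ := (h.symm.trans (E0.flipOn_left a x).symm).exists_eq_flipOn
  exact ⟨b, hb ▸ ha⟩

/-- Topological zero-one law: a Borel `E₀`-invariant set is meagre or comeagre. -/
theorem residual_zero_one {S : Set (ℕ → Bool)} (hS : MeasurableSet S)
    (hinv : ∀ x y, E0 x y → x ∈ S → y ∈ S) :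
    (∀ᶠ x in residual (ℕ → Bool), x ∈ S) ∨ ∀ᶠ x in residual (ℕ → Bool), x ∉ S := by
  obtain ⟨U, hU, hSU⟩ := hS.residualEq_isOpen
  have hSU : ∀ᶠ x in residual (ℕ → Bool), x ∈ S ↔ x ∈ U :=
    hSU.mono fun x hx => iff_of_eq hx
  rcases U.eq_empty_or_nonempty with rfl | ⟨u, hu⟩
  · exact Or.inr (hSU.mono fun x hx => by simp [hx])
  left
  obtain ⟨_, ⟨⟨v, n, rfl⟩, huv, hvU⟩⟩ :=
    (PiNat.isTopologicalBasis_cylinders (fun _ : ℕ => Bool)).exists_subset_of_mem_open hu hU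
  have hall : ∀ᶠ x in residual (ℕ → Bool), ∀ a : Finset ℕ,
      flipOn (a : Set ℕ) x ∈ S ↔ flipOn (a : Set ℕ) x ∈ U :=
    eventually_countable_forall.2 fun a => eventually_residual_flipOn _ hSU
  filter_upwards [hall] with x hx
  have hxy : E0 x (fun k => if k < n then v k else x k) :=
    ⟨n, fun k hk => by simp [not_lt.2 hk.le]⟩
  obtain ⟨a, ha⟩ := hxy.exists_eq_flipOn
  refine hinv _ _ (E0.flipOn_left a x) ((hx a).2 (hvU ?_))
  rw [← ha, PiNat.mem_cylinder_iff]
  intro i hi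
  simp [hi]

/-- `S` is covered by countably many Borel partial transversals of `E₀`. -/
def E0Small (S : Set (ℕ → Bool)) : Prop :=
  ∃ D : ℕ → Set (ℕ → Bool), (∀ n, MeasurableSet (D n)) ∧
    (∀ n, ∀ x ∈ D n, ∀ y ∈ D n, E0 x y → x = y) ∧ S ⊆ ⋃ n, D n

theorem E0Small.mono {S T : Set (ℕ → Bool)} (h : E0Small T) (hST : S ⊆ T) : E0Small S :=
  let ⟨D, hD, hD', hT⟩ := h
  ⟨D, hD, hD', hST.trans hT⟩

theorem E0Small.iUnion {ι : Type*} [Countable ι] {S : ι → Set (ℕ → Bool)}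
    (h : ∀ i, E0Small (S i)) : E0Small (⋃ i, S i) := by
  rcases isEmpty_or_nonempty ι with _ | _
  · exact ⟨fun _ => ∅, fun _ => .empty, by simp, by simp⟩
  choose D hD hD' hS using h
  obtain ⟨e, he⟩ := exists_surjective_nat (ι × ℕ)
  refine ⟨fun n => D (e n).1 (e n).2, fun n => hD _ _, fun n => hD' _ _, ?_⟩
  refine iUnion_subset fun i x hx => ?_
  obtain ⟨n, hn⟩ := mem_iUnion.1 (hS i hx)
  obtain ⟨k, hk⟩ := he (i, n)
  exact mem_iUnion.2 ⟨k, by rwa [hk]⟩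

theorem e0Small_empty : E0Small ∅ :=
  ⟨fun _ => ∅, fun _ => .empty, by simp, empty_subset _⟩

theorem E0Small.exists_measurableSet {S : Set (ℕ → Bool)} (h : E0Small S) :
    ∃ C, MeasurableSet C ∧ E0Small C ∧ S ⊆ C :=
  let ⟨D, hD, hD', hS⟩ := h
  ⟨⋃ n, D n, .iUnion hD, ⟨D, hD, hD', Subset.rfl⟩, hS⟩

/-- An analytic partial transversal of `E₀` is contained in a Borel one. -/
theorem E0Small.of_analyticSet {T : Set (ℕ → Bool)} (hT : AnalyticSet T)
    (h : ∀ x ∈ T, ∀ y ∈ T, E0 x y → x = y) : E0Small T := by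
  let I := {a : Finset ℕ // a.Nonempty}
  have hne : ∀ (a : I) (x : ℕ → Bool), flipOn ((a : Finset ℕ) : Set ℕ) x ≠ x := by
    rintro ⟨a, k, hk⟩ x hx
    simpa [flipOn, hk] using congrFun hx k
  have hT' : AnalyticSet (⋃ a : I, flipOn ((a : Finset ℕ) : Set ℕ) '' T) :=
    AnalyticSet.iUnion fun a => hT.image_of_continuous (continuous_flipOn _)
  obtain ⟨D, hTD, hD', hD⟩ := hT.measurablySeparable hT' (by
    refine Set.disjoint_left.2 fun x hx hx' => ?_
    obtain ⟨a, y, hy, rfl⟩ := mem_iUnion.1 hx'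
    exact hne a y (h _ hx _ hy (E0.flipOn_left _ _)))
  refine ⟨fun _ => D \ ⋃ a : I, flipOn ((a : Finset ℕ) : Set ℕ) ⁻¹' D,
    fun _ => hD.diff (.iUnion fun a => (continuous_flipOn _).measurable hD), ?_, ?_⟩
  · rintro - x ⟨hx, hx'⟩ y ⟨hy, -⟩ hxy
    obtain ⟨a, rfl⟩ := hxy.exists_eq_flipOn
    rcases a.eq_empty_or_nonempty with rfl | ha
    · exact (flipOn_empty x).symm
    · exact absurd (mem_iUnion.2 ⟨⟨a, ha⟩, hy⟩) hx'
  · refine fun x hx => mem_iUnion.2 ⟨0, hTD hx, fun hx' => ?_⟩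
    obtain ⟨a, ha⟩ := mem_iUnion.1 hx'
    exact Set.disjoint_left.1 hD' (mem_iUnion.2 ⟨a, x, hx, rfl⟩) ha

/-- The range of a Borel reduction of `E₀` to itself is not covered by countably many Borel
partial transversals. -/
theorem not_e0Small_range {f : (ℕ → Bool) → (ℕ → Bool)} (hf : Measurable f)
    (hred : ∀ x y, E0 x y ↔ E0 (f x) (f y)) : ¬ E0Small (range f) := by
  rintro ⟨D, hD, hD', hcov⟩
  have hinv (S : Set (ℕ → Bool)) (x y) (h : E0 x y)
      (hx : x ∈ {x | ∃ a : Finset ℕ, flipOn (a : Set ℕ) x ∈ S}) :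
      y ∈ {x | ∃ a : Finset ℕ, flipOn (a : Set ℕ) x ∈ S} := exists_flipOn_congr h hx
  obtain ⟨n, hn⟩ : ∃ n, ∀ᶠ x in residual (ℕ → Bool), ∃ a : Finset ℕ,
      flipOn (a : Set ℕ) x ∈ f ⁻¹' D n := by
    by_contra hcon
    have hcon := not_exists.1 hcon
    have : ∀ᶠ x in residual (ℕ → Bool), ∀ n, ¬ ∃ a : Finset ℕ,
        flipOn (a : Set ℕ) x ∈ f ⁻¹' D n :=
      eventually_countable_forall.2 fun n => (residual_zero_one
        (measurableSet_exists_flipOn (hf (hD n))) (hinv _)).resolve_left (hcon n)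
    obtain ⟨x, hx⟩ := (dense_of_mem_residual this).nonempty
    obtain ⟨n, hn⟩ := mem_iUnion.1 (hcov (mem_range_self x))
    exact hx n ⟨∅, by rwa [flipOn_empty]⟩
  let S (k : ℕ) : Set (ℕ → Bool) := f ⁻¹' (D n ∩ {y | y k = true})
  have hS (k : ℕ) : MeasurableSet (S k) :=
    hf ((hD n).inter (measurableSet_eq_fun (measurable_pi_apply k) measurable_const))
  have hc : ∀ k, ∃ b : Bool, ∀ᶠ x in residual (ℕ → Bool),
      (∃ a : Finset ℕ, flipOn (a : Set ℕ) x ∈ S k) ↔ b = true := by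
    intro k
    rcases residual_zero_one (measurableSet_exists_flipOn (hS k)) (hinv _) with h | h
    · exact ⟨true, h.mono fun x hx => iff_of_true hx rfl⟩
    · exact ⟨false, h.mono fun x hx => iff_of_false hx (by simp)⟩
  choose c hc using hc
  have key : ∀ᶠ x in residual (ℕ → Bool), E0 (f x) c := by
    filter_upwards [hn, eventually_countable_forall.2 hc] with x ⟨a, ha⟩ hx
    convert (hred _ _).1 (E0.flipOn_left a x).symm
    funext k
    rw [Bool.eq_iff_iff, ← hx k]
    constructor
    · rintro ⟨b, hb, hbk⟩
      rwa [hD' n _ ha _ hb ((hred _ _).1 ((E0.flipOn_left a x).trans (E0.flipOn_left b x).symm))]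
    · exact fun h => ⟨a, ha, h⟩
  obtain ⟨x, hx, hx'⟩ :=
    (dense_of_mem_residual (key.and (eventually_residual_flipOn univ key))).nonempty
  obtain ⟨m, hm⟩ := (hred _ _).2 (hx.trans hx'.symm)
  simpa [flipOn] using hm (m + 1) (Nat.lt_succ_self m)

end E0

section Concatenation

theorem polishSpace_cantor : PolishSpace (ℕ → Bool) := by
  have : PolishSpace Bool := (Topology.IsClosedEmbedding.of_continuous_injective_isClosedMap
    (f := Bool.toNat) continuous_of_discreteTopology (by decide)
    fun _ _ => isClosed_discrete _).polishSpace
  infer_instance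

/-- The infinite sequence `s ⌢ z`. -/
def prependList (s : List Bool) (z : ℕ → Bool) : ℕ → Bool :=
  fun k => if k < s.length then s.getD k false else z (k - s.length)

theorem prependList_of_lt {s : List Bool} {k : ℕ} (h : k < s.length) (z : ℕ → Bool) :
    prependList s z k = s.getD k false := if_pos h

@[simp]
theorem prependList_nil (z : ℕ → Bool) : prependList [] z = z := by
  funext k
  simp [prependList]

theorem prependList_add_length (s : List Bool) (z : ℕ → Bool) (k : ℕ) :
    prependList s z (k + s.length) = z k := by
  simp [prependList]

theorem prependList_append (s t : List Bool) (z : ℕ → Bool) :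
    prependList (s ++ t) z = prependList s (prependList t z) := by
  funext k
  rcases lt_or_ge k s.length with h | h
  · rw [prependList_of_lt h, prependList_of_lt (by simp; omega), List.getD_append _ _ _ _ h]
  · obtain ⟨j, rfl⟩ := Nat.exists_eq_add_of_le' h
    rw [prependList_add_length]
    by_cases hj : j < t.length
    · rw [prependList_of_lt (by simp; omega), prependList_of_lt hj,
        List.getD_append_right _ _ _ _ h, Nat.add_sub_cancel]
    · rw [prependList, prependList, if_neg (by simp; omega), if_neg hj, List.length_append]
      congr 1
      omega

theorem continuous_prependList (s : List Bool) : Continuous (prependList s) := by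
  refine continuous_pi fun k => ?_
  by_cases h : k < s.length
  · simpa only [prependList, h, if_true] using continuous_const
  · simpa only [prependList, h, if_false] using continuous_apply _

theorem prependList_injective (s : List Bool) : Injective (prependList s) := fun x y h =>
  funext fun k => by rw [← prependList_add_length s x, h, prependList_add_length]

theorem E0.of_prependList {s : List Bool} {x y : ℕ → Bool}
    (h : E0 (prependList s x) (prependList s y)) : E0 x y := by
  obtain ⟨n, hn⟩ := h
  exact ⟨n, fun k hk => by
    simpa only [prependList_add_length] using hn (k + s.length) (by omega)⟩

theorem prependList_ofFn (x : ℕ → Bool) (l : ℕ) :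
    prependList (List.ofFn fun i : Fin l => x i) (fun k => x (k + l)) = x := by
  funext k
  rcases lt_or_ge k l with h | h
  · simp [prependList, h]
  · simp [prependList, not_lt.2 h, Nat.sub_add_cancel h]

theorem E0Small.image_prependList {S : Set (ℕ → Bool)} (h : E0Small S) (s : List Bool) :
    E0Small (prependList s '' S) := by
  have := polishSpace_cantor
  obtain ⟨D, hD, hD', hS⟩ := h
  refine ⟨fun n => prependList s '' D n, fun n =>
    (hD n).image_of_continuousOn_injOn (continuous_prependList s).continuousOn
      (prependList_injective s).injOn, ?_, ?_⟩
  · rintro n _ ⟨x, hx, rfl⟩ _ ⟨y, hy, rfl⟩ hxy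
    rw [hD' n x hx y hy hxy.of_prependList]
  · rw [← image_iUnion]
    exact image_mono hS

/-- An analytic set which is not small splits along two finite strings of the same length that
first differ after a common part `w`. -/
theorem exists_splitting_of_not_e0Small {B : Set (ℕ → Bool)} (hB : AnalyticSet B)
    (hs : ¬ E0Small B) :
    ∃ (w : List Bool) (v : Bool → List Bool), (∀ i, (v i).head? = some i) ∧
      (v false).length = (v true).length ∧
      ¬ E0Small {z | ∀ i, prependList (w ++ v i) z ∈ B} := by
  have := polishSpace_cantor
  by_contra! hcon
  let I := {p : List Bool × (Bool → List Bool) //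
    (∀ i, (p.2 i).head? = some i) ∧ (p.2 false).length = (p.2 true).length}
  have hsmall : E0Small (⋃ p : I, prependList (p.1.1 ++ p.1.2 false) ''
      {z | ∀ i, prependList (p.1.1 ++ p.1.2 i) z ∈ B}) :=
    E0Small.iUnion fun p => (hcon p.1.1 p.1.2 p.2.1 p.2.2).image_prependList _
  obtain ⟨C, hC, hCs, hsub⟩ := hsmall.exists_measurableSet
  have key : ∀ x ∈ B, ∀ y ∈ B, E0 x y → ∀ j, (∀ i < j, x i = y i) → x j = false → y j = true →
      x ∈ C := by
    intro x hx y hy ⟨n, hn⟩ j hj hxj hyj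
    let w := List.ofFn fun i : Fin j => x i
    let l := n + 1
    let v (z : ℕ → Bool) := List.ofFn fun i : Fin (l + 1) => z (i + j)
    let t : ℕ → Bool := fun k => x (k + (l + 1) + j)
    have hw : w = List.ofFn fun i : Fin j => y i := congrArg List.ofFn (funext fun i => hj i i.2)
    have ht : t = fun k => y (k + (l + 1) + j) := funext fun k => hn _ (by omega)
    have hx' : prependList (w ++ v x) t = x := by
      rw [prependList_append, prependList_ofFn (fun k => x (k + j)), prependList_ofFn]
    have hy' : prependList (w ++ v y) t = y := by
      rw [prependList_append, ht, prependList_ofFn (fun k => y (k + j)), hw, prependList_ofFn]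
    refine hsub (mem_iUnion.2 ⟨⟨(w, fun i => bif i then v y else v x), ?_, by simp [v]⟩,
      t, ?_, hx'⟩)
    · rintro (_ | _) <;> simp [v, List.ofFn_succ, hxj, hyj]
    · rintro (_ | _)
      · simpa [hx'] using hx
      · simpa [hy'] using hy
  refine hs ((E0Small.iUnion (ι := Bool) (S := fun b => bif b then C else B \ C) ?_).mono
    fun x hx => ?_)
  · rintro (_ | _)
    · refine E0Small.of_analyticSet ?_ fun x hx y hy hxy => ?_
      · have := AnalyticSet.iInter (s := fun b : Bool => bif b then B else Cᶜ)
          (by rintro (_ | _); exacts [hC.compl.analyticSet, hB])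
        convert this using 1
        ext x
        simp [Bool.forall_bool, and_comm]
      · by_contra hne
        have hex : ∃ j, x j ≠ y j := Function.ne_iff.1 hne
        classical
        have hmin : ∀ i < Nat.find hex, x i = y i := fun i hi => not_not.1 (Nat.find_min hex hi)
        have hfind := Nat.find_spec hex
        cases hxj : x (Nat.find hex) <;> cases hyj : y (Nat.find hex)
        · exact hfind (hxj.trans hyj.symm)
        · exact hx.2 (key x hx.1 y hy.1 hxy _ hmin hxj hyj)
        · exact hy.2 (key y hy.1 x hx.1 hxy.symm _ (fun i hi => (hmin i hi).symm) hyj hxj)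
        · exact hfind (hxj.trans hyj.symm)
    · exact hCs
  · by_cases hxC : x ∈ C
    · exact mem_iUnion.2 ⟨true, hxC⟩
    · exact mem_iUnion.2 ⟨false, hx, hxC⟩

end Concatenation

section Fusion

theorem blockPrefix_append (s t : List Bool) (v : ℕ → Bool → List Bool) (x : ℕ → Bool) (n : ℕ) :
    blockPrefix (s ++ t) v x n = s ++ blockPrefix t v x n := by
  induction n with
  | zero => rfl
  | succ n ih => simp [blockPrefix, ih]

theorem IsE0Blocks.le_length_blockPrefix {v : ℕ → Bool → List Bool} (hv : IsE0Blocks v)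
    (s : List Bool) (x : ℕ → Bool) (n : ℕ) : n ≤ (blockPrefix s v x n).length := by
  induction n with
  | zero => exact Nat.zero_le _
  | succ n ih =>
    have : v n (x n) ≠ [] := fun h => by simpa [h] using hv.1 n (x n)
    have := List.length_pos_of_ne_nil this
    simp only [blockPrefix, List.length_append]
    omega

theorem IsE0Blocks.getD_blockPrefix {v : ℕ → Bool → List Bool} (hv : IsE0Blocks v)
    (s : List Bool) (x : ℕ → Bool) {k n : ℕ} (h : k < n) :
    (blockPrefix s v x n).getD k false = e0TreeMapOf s v x k := by
  induction n, h using Nat.le_induction with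
  | base => rfl
  | succ n hn ih =>
    rw [blockPrefix, List.getD_append _ _ _ _ (hn.trans (hv.le_length_blockPrefix s x n)), ih]

theorem IsE0Blocks.e0TreeMapOf_append {v : ℕ → Bool → List Bool} (hv : IsE0Blocks v)
    (s t : List Bool) (x : ℕ → Bool) :
    e0TreeMapOf (s ++ t) v x = prependList s (e0TreeMapOf t v x) := by
  funext k
  rw [e0TreeMapOf, blockPrefix_append]
  rcases lt_or_ge k s.length with h | h
  · rw [prependList_of_lt h, List.getD_append _ _ _ _ h]
  · rw [List.getD_append_right _ _ _ _ h, prependList, if_neg (not_lt.2 h)]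
    exact hv.getD_blockPrefix _ _ (by omega)

/-- The image under `p` of the sequences that agree with `b` below `m`. -/
def cylinderImage (p : (ℕ → ℕ) → (ℕ → Bool)) (m : ℕ) (b : ℕ → ℕ) : Set (ℕ → Bool) :=
  p '' {y | ∀ i < m, y i = b i}

variable {p : (ℕ → ℕ) → (ℕ → Bool)}

theorem analyticSet_cylinderImage (hp : Continuous p) (m : ℕ) (b : ℕ → ℕ) :
    AnalyticSet (cylinderImage p m b) := by
  have := polishSpace_cantor
  exact (PiNat.isOpen_cylinder (fun _ : ℕ => ℕ) b m).analyticSet_image hp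

/-- The tails that, for every `x`, are sent by the prefix `σ x` into the piece indexed by `b x`. -/
def fusionTails (p : (ℕ → ℕ) → (ℕ → Bool)) (m : ℕ) (σ : (Fin m → Bool) → List Bool)
    (b : (Fin m → Bool) → ℕ → ℕ) : Set (ℕ → Bool) :=
  {z | ∀ x, prependList (σ x) z ∈ cylinderImage p m (b x)}

theorem exists_fusion_step (hp : Continuous p) (m : ℕ) (σ : (Fin m → Bool) → List Bool)
    (b : (Fin m → Bool) → ℕ → ℕ) (h : ¬ E0Small (fusionTails p m σ b)) :
    ∃ (w : List Bool) (v : Bool → List Bool) (b' : (Fin (m + 1) → Bool) → ℕ → ℕ),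
      (∀ i, (v i).head? = some i) ∧ (v false).length = (v true).length ∧
      (∀ x, ∀ i < m, b' x i = b (Fin.init x) i) ∧
      ¬ E0Small (fusionTails p (m + 1) (fun x => σ (Fin.init x) ++ w ++ v (x (Fin.last m))) b') := by
  have := polishSpace_cantor
  have hB : AnalyticSet (fusionTails p m σ b) := by
    have := AnalyticSet.iInter fun x =>
      (analyticSet_cylinderImage hp m (b x)).preimage (continuous_prependList (σ x))
    convert this using 1
    ext z
    simp [fusionTails]
  obtain ⟨w, v, hv, hl, hs⟩ := exists_splitting_of_not_e0Small hB h
  by_contra! hcon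
  refine hs ((E0Small.iUnion fun n : (Fin (m + 1) → Bool) → ℕ =>
    hcon w v (fun x => update (b (Fin.init x)) m (n x)) hv hl
      fun x i hi => update_of_ne hi.ne _ _).mono fun z hz => ?_)
  have hz' : ∀ x : Fin (m + 1) → Bool, ∃ n,
      prependList (σ (Fin.init x) ++ w ++ v (x (Fin.last m))) z ∈
        cylinderImage p (m + 1) (update (b (Fin.init x)) m n) := by
    intro x
    obtain ⟨y, hy, hyz⟩ := hz (x (Fin.last m)) (Fin.init x)
    refine ⟨y m, y, fun i hi => ?_, ?_⟩
    · rcases Nat.lt_succ_iff_lt_or_eq.1 hi with hi | rfl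
      · rw [update_of_ne hi.ne, hy i hi]
      · rw [update_self]
    · rw [hyz, List.append_assoc, prependList_append (σ _)]
  choose n hn using hz'
  exact mem_iUnion.2 ⟨n, hn⟩

/-- An analytic set that is not covered by countably many Borel partial transversals of `E₀`
contains the range of an `E₀`-tree map. -/
theorem exists_e0Tree_of_not_e0Small {B : Set (ℕ → Bool)} (hB : AnalyticSet B)
    (hs : ¬ E0Small B) :
    ∃ s v, IsE0Blocks v ∧ range (e0TreeMapOf s v) ⊆ B := by
  rw [AnalyticSet] at hB
  rcases hB with rfl | ⟨p, hp, rfl⟩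
  · exact absurd e0Small_empty hs
  choose w v b hv hl hb hgood using exists_fusion_step hp
  let Stage (m : ℕ) := {q : ((Fin m → Bool) → List Bool) × ((Fin m → Bool) → ℕ → ℕ) //
    ¬ E0Small (fusionTails p m q.1 q.2)}
  let next (m : ℕ) (q : Stage m) : Stage (m + 1) :=
    ⟨(fun x => q.1.1 (Fin.init x) ++ w m _ _ q.2 ++ v m _ _ q.2 (x (Fin.last m)), b m _ _ q.2),
      hgood m _ _ q.2⟩
  let start : Stage 0 := ⟨(fun _ => [], fun _ _ => 0), fun h => hs (h.mono (by
    rintro _ ⟨y, rfl⟩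
    exact fun _ => ⟨y, by simp, by simp⟩))⟩
  let Q (m : ℕ) : Stage m := Nat.rec start next m
  have hQ (m : ℕ) : Q (m + 1) = next m (Q m) := rfl
  let W (m : ℕ) : List Bool := w m _ _ (Q m).2
  let V (m : ℕ) (i : Bool) : List Bool := v m _ _ (Q m).2 i ++ W (m + 1)
  have hV : IsE0Blocks V :=
    ⟨fun m i => by simp [V, List.head?_append, hv], fun m => by simp [V, hl m _ _ (Q m).2]⟩
  let r (x : ℕ → Bool) (m : ℕ) : Fin m → Bool := fun i => x i
  have hpre (x : ℕ → Bool) (m : ℕ) : (Q m).1.1 (r x m) ++ W m = blockPrefix (W 0) V x m := by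
    induction m with
    | zero => rfl
    | succ m ih =>
      rw [blockPrefix, ← ih, hQ]
      simp [next, V, W, hQ, r, Fin.init_def]
  refine ⟨W 0, V, hV, ?_⟩
  rintro _ ⟨x, rfl⟩
  let β (m : ℕ) : ℕ := (Q (m + 1)).1.2 (r x (m + 1)) m
  have hβ (m : ℕ) : ∀ i < m, (Q m).1.2 (r x m) i = β i := by
    induction m with
    | zero => simp
    | succ m ih =>
      intro i hi
      rcases Nat.lt_succ_iff_lt_or_eq.1 hi with hi | rfl
      · exact (hb m _ _ (Q m).2 (r x (m + 1)) i hi).trans (ih i hi)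
      · rfl
  have hy (m : ℕ) : ∃ y : ℕ → ℕ, (∀ i < m, y i = β i) ∧
      ∀ k < m, p y k = e0TreeMapOf (W 0) V x k := by
    obtain ⟨z, hz⟩ : (fusionTails p (m + 1) (Q (m + 1)).1.1 (Q (m + 1)).1.2).Nonempty := by
      exact nonempty_iff_ne_empty.2 fun h => (Q (m + 1)).2 (h ▸ e0Small_empty)
    obtain ⟨y, hy, hyz⟩ := hz (r x (m + 1))
    refine ⟨y, fun i hi => (hy i (by omega)).trans (hβ (m + 1) i (by omega)), fun k hk => ?_⟩
    have hpre' : (Q (m + 1)).1.1 (r x (m + 1)) =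
        blockPrefix (W 0) V x m ++ v m _ _ (Q m).2 (x m) := by
      rw [← hpre x m]
      rfl
    rw [hyz, hpre', prependList_append,
      prependList_of_lt (hk.trans_le (hV.le_length_blockPrefix _ _ _)),
      hV.getD_blockPrefix _ _ hk]
  choose y hyβ hyx using hy
  have hlim : Tendsto y atTop (𝓝 β) := tendsto_pi_nhds.2 fun i =>
    tendsto_const_nhds.congr' <| (eventually_gt_atTop i).mono fun m hm => (hyβ m i hm).symm
  refine ⟨β, funext fun k => tendsto_nhds_unique
    (((continuous_apply k).comp hp).continuousAt.tendsto.comp hlim) ?_⟩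
  exact tendsto_const_nhds.congr' <| (eventually_gt_atTop k).mono fun m hm => (hyx m k hm).symm

end Fusion

/-- If `A 0, …, A (n-1)` are analytic, each admits a Borel reduction of `E₀` into its
restriction, and their `E₀`-saturations increase, then there are `E₀`-tree maps into the `A k`
with stems of a common length and identical blocks. -/
theorem e0_trees_with_common_blocks (n : ℕ) (A : Fin n → Set (ℕ → Bool))
    (hA : ∀ k, MeasureTheory.AnalyticSet (A k))
    (hred : ∀ k, ∃ f : (ℕ → Bool) → (ℕ → Bool),
      Measurable f ∧ range f ⊆ A k ∧ ∀ x y, E0 x y ↔ E0 (f x) (f y))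
    (hsat : ∀ (k : Fin n) (h : (k : ℕ) + 1 < n), satE0 (A k) ⊆ satE0 (A ⟨(k : ℕ) + 1, h⟩)) :
    ∃ (s : Fin n → List Bool) (v : ℕ → Bool → List Bool),
      (∀ k l, (s k).length = (s l).length) ∧ IsE0Blocks v ∧
      ∀ k, range (e0TreeMapOf (s k) v) ⊆ A k := by
  rcases n with _ | n
  · exact ⟨fun k => k.elim0, fun _ i => [i], fun k => k.elim0, ⟨fun _ _ => rfl, fun _ => rfl⟩,
      fun k => k.elim0⟩
  have := polishSpace_cantor
  have hchain (x) (hx : x ∈ A 0) (k : Fin (n + 1)) : x ∈ satE0 (A k) := by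
    induction k using Fin.induction with
    | zero => exact ⟨x, hx, 0, fun _ _ => rfl⟩
    | succ k ih => exact hsat k.castSucc (by simp) ih
  let I := {s : Fin (n + 1) → List Bool // ∀ k l, (s k).length = (s l).length}
  let B (s : I) : Set (ℕ → Bool) := {z | ∀ k, prependList (s.1 k) z ∈ A k}
  have hB (s : I) : AnalyticSet (B s) := by
    have := AnalyticSet.iInter fun k => (hA k).preimage (continuous_prependList (s.1 k))
    convert this using 1
    ext z
    simp [B]
  obtain ⟨s, hs⟩ : ∃ s : I, ¬ E0Small (B s) := by
    by_contra! hcon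
    obtain ⟨f, hf, hfA, hred⟩ := hred 0
    refine not_e0Small_range hf hred
      ((E0Small.iUnion fun s : I => (hcon s).image_prependList (s.1 0)).mono fun x hx => ?_)
    have hx := hfA hx
    choose y hyA N hN using hchain x hx
    obtain ⟨M, hM⟩ := (Set.finite_range N).bddAbove
    have htail (k) : (fun i => x (i + (M + 1))) = fun i => y k (i + (M + 1)) := funext fun i =>
      (hN k _ (by have := hM (mem_range_self k); omega)).symm
    let z : Fin (n + 1) → ℕ → Bool := fun k => if k = 0 then x else y k
    have hz (k) : z k ∈ A k ∧ (fun i => x (i + (M + 1))) = fun i => z k (i + (M + 1)) := by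
      by_cases hk : k = 0
      · subst hk; exact ⟨by simpa [z] using hx, by simp [z]⟩
      · simpa [z, hk] using ⟨hyA k, htail k⟩
    refine mem_iUnion.2 ⟨⟨fun k => List.ofFn fun i : Fin (M + 1) => z k i, by simp⟩,
      fun i => x (i + (M + 1)), fun k => ?_, ?_⟩
    · rw [(hz k).2, prependList_ofFn]
      exact (hz k).1
    · rw [(hz 0).2, prependList_ofFn]
      simp [z]
  obtain ⟨t, v, hv, ht⟩ := exists_e0Tree_of_not_e0Small (hB s) hs
  refine ⟨fun k => s.1 k ++ t, v, fun k l => by simp [s.2 k l], hv, fun k => ?_⟩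
  rintro _ ⟨x, rfl⟩
  rw [hv.e0TreeMapOf_append]
  exact ht (mem_range_self x) k
end

section
/- There is a continuous function Q : [2^ω]³_{E_0} → 2^ω such that for every E_0-tree map Φ, Q[[range Φ]³_{E_0}] = 2^ω. -/
open Set Function

/-- `Φ` is an `E₀`-tree map. -/
def IsE0TreeMap (Φ : (ℕ → Bool) → (ℕ → Bool)) : Prop :=
  ∃ s v, IsE0Blocks v ∧ Φ = e0TreeMapOf s v

/-- `[B]³_{E₀}`: triples from `B` that are pairwise `E₀`-inequivalent. -/
def triplesE0 (B : Set (ℕ → Bool)) : Set ((ℕ → Bool) × (ℕ → Bool) × (ℕ → Bool)) :=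
  {p | p.1 ∈ B ∧ p.2.1 ∈ B ∧ p.2.2 ∈ B ∧
    ¬E0 p.1 p.2.1 ∧ ¬E0 p.1 p.2.2 ∧ ¬E0 p.2.1 p.2.2}

open Filter Topology

/-! ### Decoding a stream of letters -/

/-- Read one symbol of a stream over the letters `ZMod 3`. A letter differing from the last one read
is recorded, and contributes a bit saying whether it is the cyclic successor. -/
def readSymbol (st : ZMod 3 × List Bool) : Option (ZMod 3) → ZMod 3 × List Bool
  | none => st
  | some a => if a = st.1 then st else (a, st.2 ++ [decide (a = st.1 + 1)])

/-- The state reached after reading the first `m` symbols of a stream. -/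
def readStream (d : ℕ → Option (ZMod 3)) : ℕ → ZMod 3 × List Bool
  | 0 => (0, [])
  | m + 1 => readSymbol (readStream d m) (d m)

lemma readStream_congr {d e : ℕ → Option (ZMod 3)} {m : ℕ} (h : ∀ i < m, d i = e i) :
    readStream d m = readStream e m := by
  induction m with
  | zero => rfl
  | succ m ih =>
    rw [readStream, readStream, ih fun i hi => h i (by omega), h m (by omega)]

lemma snd_prefix_readSymbol (st : ZMod 3 × List Bool) (o : Option (ZMod 3)) :
    st.2 <+: (readSymbol st o).2 := by
  cases o with
  | none => exact List.prefix_rfl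
  | some a =>
    by_cases h : a = st.1
    · simp [readSymbol, h]
    · simp [readSymbol, h]

lemma readStream_isPrefix_of_le (d : ℕ → Option (ZMod 3)) {m n : ℕ} (h : m ≤ n) :
    (readStream d m).2 <+: (readStream d n).2 := by
  induction n, h using Nat.le_induction with
  | base => exact List.prefix_rfl
  | succ n _ ih => exact ih.trans (snd_prefix_readSymbol _ _)

lemma readSymbol_eq_of_length_le {st : ZMod 3 × List Bool} {o : Option (ZMod 3)}
    (h : (readSymbol st o).2.length ≤ st.2.length) : readSymbol st o = st := by
  cases o with
  | none => rfl
  | some a =>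
    by_cases ha : a = st.1
    · simp [readSymbol, ha]
    · simp [readSymbol, ha] at h

lemma readStream_eq_of_forall {d : ℕ → Option (ZMod 3)} {m n : ℕ} (h : m ≤ n)
    (hd : ∀ i, m ≤ i → i < n → d i = none ∨ d i = some (readStream d m).1) :
    readStream d n = readStream d m := by
  induction n, h using Nat.le_induction with
  | base => rfl
  | succ n hmn ih =>
    rw [readStream, ih fun i hi hi' => hd i hi (by omega)]
    rcases hd n hmn (by omega) with h | h <;> simp [h, readSymbol]

lemma exists_lt_length_readStream {d : ℕ → Option (ZMod 3)}
    (hd : ∀ a n, ∃ m > n, d m ≠ none ∧ d m ≠ some a) (k : ℕ) :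
    ∃ m, k < (readStream d m).2.length := by
  have grow : ∀ n, ∃ m, (readStream d n).2.length < (readStream d m).2.length := by
    intro n
    by_contra! hn
    have const : ∀ m, n ≤ m → readStream d m = readStream d n := by
      intro m hm
      induction m, hm using Nat.le_induction with
      | base => rfl
      | succ m _ ih =>
        have := hn (m + 1)
        rw [readStream, ih] at this ⊢
        exact readSymbol_eq_of_length_le this
    obtain ⟨m, hm, h0, h1⟩ := hd (readStream d n).1 n
    obtain ⟨a, ha⟩ := Option.ne_none_iff_exists'.1 h0
    have hstep := const (m + 1) (by omega)
    rw [readStream, const m hm.le, ha] at hstep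
    have hne : a ≠ (readStream d n).1 := fun h => h1 (by rw [ha, h])
    rw [readSymbol, if_neg hne] at hstep
    exact hne (congrArg Prod.fst hstep)
  induction k with
  | zero =>
    obtain ⟨m, hm⟩ := grow 0
    exact ⟨m, by omega⟩
  | succ k ih =>
    obtain ⟨n, hn⟩ := ih
    obtain ⟨m, hm⟩ := grow n
    exact ⟨m, by omega⟩

open Classical in
/-- The limit of the bit lists produced by reading a stream, padded with `false`. -/
noncomputable def decodeStream (d : ℕ → Option (ZMod 3)) (k : ℕ) : Bool :=
  if h : ∃ m, k < (readStream d m).2.length then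
    (readStream d h.choose).2.getD k false
  else false

lemma List.IsPrefix.getD_eq {α : Type*} {l l' : List α} (h : l <+: l') {k : ℕ}
    (hk : k < l.length) (a : α) : l'.getD k a = l.getD k a := by
  obtain ⟨r, rfl⟩ := h
  exact List.getD_append _ _ _ _ hk

lemma decodeStream_eq {d : ℕ → Option (ZMod 3)} {k m : ℕ}
    (h : k < (readStream d m).2.length) :
    decodeStream d k = (readStream d m).2.getD k false := by
  have hex : ∃ m, k < (readStream d m).2.length := ⟨m, h⟩
  rw [decodeStream, dif_pos hex]
  rcases le_total hex.choose m with hle | hle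
  · exact ((readStream_isPrefix_of_le d hle).getD_eq hex.choose_spec _).symm
  · exact (readStream_isPrefix_of_le d hle).getD_eq h _

/-! ### The odd one out of a triple of sequences -/

/-- The index of the entry that disagrees with the two others, if there is one. -/
def oddOneOut (a b c : Bool) : Option (ZMod 3) :=
  if b = c then (if a = b then none else some 0) else if a = c then some 1 else some 2

/-- The stream of odd ones out of a triple of sequences. -/
def oddStream (p : (ℕ → Bool) × (ℕ → Bool) × (ℕ → Bool)) (i : ℕ) : Option (ZMod 3) :=
  oddOneOut (p.1 i) (p.2.1 i) (p.2.2 i)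

lemma exists_ne_of_not_E0 {x y : ℕ → Bool} (h : ¬E0 x y) (n : ℕ) : ∃ m > n, x m ≠ y m := by
  simp only [E0, not_exists] at h
  simpa using h n

lemma oddOneOut_ne : ∀ a b c : Bool,
    (b ≠ c → oddOneOut a b c ≠ none ∧ oddOneOut a b c ≠ some 0) ∧
    (a ≠ c → oddOneOut a b c ≠ none ∧ oddOneOut a b c ≠ some 1) ∧
    (a ≠ b → oddOneOut a b c ≠ none ∧ oddOneOut a b c ≠ some 2) := by
  decide

lemma exists_oddStream_ne {p : (ℕ → Bool) × (ℕ → Bool) × (ℕ → Bool)}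
    (hp : p ∈ triplesE0 univ) (a : ZMod 3) (n : ℕ) :
    ∃ m > n, oddStream p m ≠ none ∧ oddStream p m ≠ some a := by
  obtain ⟨-, -, -, h01, h02, h12⟩ := hp
  have ha : a = 0 ∨ a = 1 ∨ a = 2 := by revert a; decide
  rcases ha with rfl | rfl | rfl
  · obtain ⟨m, hm, h⟩ := exists_ne_of_not_E0 h12 n
    exact ⟨m, hm, (oddOneOut_ne _ _ _).1 h⟩
  · obtain ⟨m, hm, h⟩ := exists_ne_of_not_E0 h02 n
    exact ⟨m, hm, (oddOneOut_ne _ _ _).2.1 h⟩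
  · obtain ⟨m, hm, h⟩ := exists_ne_of_not_E0 h01 n
    exact ⟨m, hm, (oddOneOut_ne _ _ _).2.2 h⟩

lemma eventually_oddStream_eq (p : (ℕ → Bool) × (ℕ → Bool) × (ℕ → Bool)) (i : ℕ) :
    ∀ᶠ q in 𝓝 p, oddStream q i = oddStream p i := by
  have hc : Continuous fun q : (ℕ → Bool) × (ℕ → Bool) × (ℕ → Bool) =>
      (q.1 i, q.2.1 i, q.2.2 i) := by fun_prop
  have := hc.tendsto p
  rw [nhds_discrete (Bool × Bool × Bool), tendsto_pure] at this
  filter_upwards [this] with q hq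
  simp only [Prod.mk.injEq] at hq
  simp [oddStream, hq]

lemma continuousOn_decodeStream_oddStream :
    ContinuousOn (fun p => decodeStream (oddStream p)) (triplesE0 univ) := by
  refine continuousOn_pi.2 fun k p hp => ?_
  obtain ⟨m, hm⟩ := exists_lt_length_readStream (exists_oddStream_ne hp) k
  have hev : ∀ᶠ q in 𝓝 p, ∀ i ∈ Finset.range m, oddStream q i = oddStream p i :=
    (Finset.eventually_all _).2 fun i _ => eventually_oddStream_eq p i
  have heq : ∀ᶠ q in 𝓝 p, decodeStream (oddStream q) k = decodeStream (oddStream p) k := by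
    filter_upwards [hev] with q hq
    have hr : readStream (oddStream q) m = readStream (oddStream p) m :=
      readStream_congr fun i hi => hq i (Finset.mem_range.2 hi)
    rw [decodeStream_eq hm, decodeStream_eq (m := m) (by rwa [hr]), hr]
  exact (continuousAt_const.congr (heq.mono fun _ h => h.symm)).continuousWithinAt

/-! ### `E₀`-tree maps blockwise -/

/-- The position at which the `n`-th block of an `E₀`-tree starts. -/
def blockStart (s : List Bool) (v : ℕ → Bool → List Bool) : ℕ → ℕ
  | 0 => s.length
  | n + 1 => blockStart s v n + (v n false).length

section Blocks

variable {s : List Bool} {v : ℕ → Bool → List Bool}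

lemma IsE0Blocks.length_eq (hv : IsE0Blocks v) (n : ℕ) (i : Bool) :
    (v n i).length = (v n false).length := by
  cases i
  · rfl
  · exact (hv.2 n).symm

lemma IsE0Blocks.length_pos (hv : IsE0Blocks v) (n : ℕ) (i : Bool) : 0 < (v n i).length := by
  have := hv.1 n i
  cases h : v n i <;> simp [h] at this ⊢

lemma IsE0Blocks.getD_zero (hv : IsE0Blocks v) (n : ℕ) (i : Bool) :
    (v n i).getD 0 false = i := by
  have := hv.1 n i
  cases h : v n i <;> simp_all

lemma length_blockPrefix (hv : IsE0Blocks v) (x : ℕ → Bool) (n : ℕ) :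
    (blockPrefix s v x n).length = blockStart s v n := by
  induction n with
  | zero => rfl
  | succ n ih => simp [blockPrefix, blockStart, ih, hv.length_eq n (x n)]

lemma le_blockStart (s : List Bool) (hv : IsE0Blocks v) (n : ℕ) : n ≤ blockStart s v n := by
  induction n with
  | zero => exact Nat.zero_le _
  | succ n ih =>
    have := hv.length_pos n false
    rw [blockStart]
    omega

lemma blockPrefix_isPrefix_of_le (x : ℕ → Bool) {m n : ℕ} (h : m ≤ n) :
    blockPrefix s v x m <+: blockPrefix s v x n := by
  induction n, h using Nat.le_induction with
  | base => exact List.prefix_rfl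
  | succ n _ ih => exact ih.trans (List.prefix_append _ _)

lemma e0TreeMapOf_eq_getD (hv : IsE0Blocks v) (x : ℕ → Bool) {m n : ℕ}
    (h : m < blockStart s v n) :
    e0TreeMapOf s v x m = (blockPrefix s v x n).getD m false := by
  have hm : m < (blockPrefix s v x (m + 1)).length := by
    rw [length_blockPrefix hv]
    exact le_blockStart s hv (m + 1)
  rw [← length_blockPrefix hv x] at h
  rcases le_total n (m + 1) with hle | hle
  · exact (blockPrefix_isPrefix_of_le x hle).getD_eq h _
  · exact ((blockPrefix_isPrefix_of_le x hle).getD_eq hm _).symm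

lemma e0TreeMapOf_stem (hv : IsE0Blocks v) (x : ℕ → Bool) {m : ℕ} (h : m < blockStart s v 0) :
    e0TreeMapOf s v x m = s.getD m false :=
  e0TreeMapOf_eq_getD hv x h

lemma e0TreeMapOf_block (hv : IsE0Blocks v) (x : ℕ → Bool) {m n : ℕ}
    (h : blockStart s v n ≤ m) (h' : m < blockStart s v (n + 1)) :
    e0TreeMapOf s v x m = (v n (x n)).getD (m - blockStart s v n) false := by
  rw [e0TreeMapOf_eq_getD hv x h', blockPrefix,
    List.getD_append_right _ _ _ _ (by rwa [length_blockPrefix hv]), length_blockPrefix hv]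

lemma e0TreeMapOf_blockStart (hv : IsE0Blocks v) (x : ℕ → Bool) (n : ℕ) :
    e0TreeMapOf s v x (blockStart s v n) = x n := by
  have := hv.length_pos n false
  rw [e0TreeMapOf_block hv x le_rfl (by rw [blockStart]; omega), Nat.sub_self, hv.getD_zero]

lemma not_E0_e0TreeMapOf (hv : IsE0Blocks v) {x y : ℕ → Bool} (h : ¬E0 x y) :
    ¬E0 (e0TreeMapOf s v x) (e0TreeMapOf s v y) := by
  rintro ⟨n, hn⟩
  obtain ⟨m, hm, hne⟩ := exists_ne_of_not_E0 h n
  refine hne ?_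
  rw [← e0TreeMapOf_blockStart (s := s) hv x m, ← e0TreeMapOf_blockStart (s := s) hv y m]
  exact hn _ (hm.trans_le (le_blockStart s hv m))

end Blocks

/-! ### Encoding a binary sequence -/

/-- The letters starting from `0` and moving to the cyclic successor or predecessor according to
the bits of `t`. -/
def letterWalk (t : ℕ → Bool) : ℕ → ZMod 3
  | 0 => 0
  | n + 1 => letterWalk t n + if t n then 1 else 2

/-- The indicator sequence of the visits of `letterWalk t` to `a` after its start. -/
def visits (t : ℕ → Bool) (a : ZMod 3) (n : ℕ) : Bool := decide (letterWalk t (n + 1) = a)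

lemma letterWalk_succ_ne (t : ℕ → Bool) (n : ℕ) : letterWalk t (n + 1) ≠ letterWalk t n := by
  rw [letterWalk]
  generalize letterWalk t n = a
  cases t n <;> revert a <;> decide

lemma letterWalk_bit (t : ℕ → Bool) (n : ℕ) :
    decide (letterWalk t (n + 1) = letterWalk t n + 1) = t n := by
  rw [letterWalk]
  generalize letterWalk t n = a
  cases t n <;> revert a <;> decide

lemma not_E0_visits (t : ℕ → Bool) {a b : ZMod 3} (hab : a ≠ b) :
    ¬E0 (visits t a) (visits t b) := by
  rintro ⟨n, hn⟩
  have key : ∀ a b w w' : ZMod 3, a ≠ b → w' ≠ w → decide (w = a) = decide (w = b) →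
      decide (w' = a) = decide (w' = b) → False := by decide
  exact key a b _ _ hab (letterWalk_succ_ne t (n + 2)) (hn (n + 1) (by omega))
    (hn (n + 2) (by omega))

lemma oddOneOut_of_indicator : ∀ (f : Bool → Bool) (w : ZMod 3),
    oddOneOut (f (decide (w = 0))) (f (decide (w = 1))) (f (decide (w = 2))) = none ∨
    oddOneOut (f (decide (w = 0))) (f (decide (w = 1))) (f (decide (w = 2))) = some w := by
  decide

lemma oddOneOut_indicator : ∀ w : ZMod 3,
    oddOneOut (decide (w = 0)) (decide (w = 1)) (decide (w = 2)) = some w := by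
  decide

/-- The triple in the range of an `E₀`-tree map encoding `t`. -/
def encodeTriple (s : List Bool) (v : ℕ → Bool → List Bool) (t : ℕ → Bool) :
    (ℕ → Bool) × (ℕ → Bool) × (ℕ → Bool) :=
  (e0TreeMapOf s v (visits t 0), e0TreeMapOf s v (visits t 1), e0TreeMapOf s v (visits t 2))

lemma readStream_encodeTriple {s : List Bool} {v : ℕ → Bool → List Bool} (hv : IsE0Blocks v)
    (t : ℕ → Bool) (n : ℕ) :
    readStream (oddStream (encodeTriple s v t)) (blockStart s v n) =
      (letterWalk t n, (List.range n).map t) := by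
  induction n with
  | zero =>
    refine readStream_eq_of_forall (Nat.zero_le _) fun i _ hi => Or.inl ?_
    simp [oddStream, encodeTriple, e0TreeMapOf_stem hv _ hi, oddOneOut]
  | succ n ih =>
    have hpos := hv.length_pos n false
    have hfirst : readStream (oddStream (encodeTriple s v t)) (blockStart s v n + 1) =
        (letterWalk t (n + 1), (List.range (n + 1)).map t) := by
      have hodd : oddStream (encodeTriple s v t) (blockStart s v n) =
          some (letterWalk t (n + 1)) := by
        simp only [oddStream, encodeTriple, e0TreeMapOf_blockStart hv]
        exact oddOneOut_indicator _
      rw [readStream, ih, hodd, readSymbol, if_neg (letterWalk_succ_ne t n), letterWalk_bit]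
      simp [List.range_succ]
    rw [← hfirst]
    refine readStream_eq_of_forall (by rw [blockStart]; omega) fun i hi hi' => ?_
    rw [hfirst]
    simp only [oddStream, encodeTriple, e0TreeMapOf_block hv _ (Nat.le_of_succ_le hi) hi']
    exact oddOneOut_of_indicator (fun b => (v n b).getD (i - blockStart s v n) false) _

lemma decodeStream_encodeTriple {s : List Bool} {v : ℕ → Bool → List Bool} (hv : IsE0Blocks v)
    (t : ℕ → Bool) : decodeStream (oddStream (encodeTriple s v t)) = t := by
  funext k
  have hr := readStream_encodeTriple (s := s) hv t (k + 1)
  rw [decodeStream_eq (m := blockStart s v (k + 1)) (by simp [hr]), hr]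
  simp

lemma encodeTriple_mem {s : List Bool} {v : ℕ → Bool → List Bool} (hv : IsE0Blocks v)
    (t : ℕ → Bool) : encodeTriple s v t ∈ triplesE0 (range (e0TreeMapOf s v)) :=
  ⟨mem_range_self _, mem_range_self _, mem_range_self _,
    not_E0_e0TreeMapOf hv (not_E0_visits t (by decide)),
    not_E0_e0TreeMapOf hv (not_E0_visits t (by decide)),
    not_E0_e0TreeMapOf hv (not_E0_visits t (by decide))⟩

/-- There is a continuous `Q : [2^ω]³_{E₀} → 2^ω` such that `Q[[range Φ]³_{E₀}] = 2^ω` for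
every `E₀`-tree map `Φ`. -/
theorem exists_Q_onto_cantor :
    ∃ Q : (ℕ → Bool) × (ℕ → Bool) × (ℕ → Bool) → (ℕ → Bool),
      ContinuousOn Q (triplesE0 univ) ∧
      ∀ Φ : (ℕ → Bool) → (ℕ → Bool), IsE0TreeMap Φ →
        Q '' triplesE0 (range Φ) = univ := by
  refine ⟨fun p => decodeStream (oddStream p), continuousOn_decodeStream_oddStream, ?_⟩
  rintro _ ⟨s, v, hv, rfl⟩
  exact eq_univ_of_forall fun t =>
    ⟨encodeTriple s v t, encodeTriple_mem hv t, decodeStream_encodeTriple hv t⟩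
end
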